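/- arXiv:math/0404328 — 3 statements merged into one kernel-verified Lean document; each statement's English description precedes it below -/
import Mathlib

section
/- Let (L, R) be a weak factorization system on the category Set of sets such that the map C: ∅ → {0} belongs to L and some member of L is not injective. Then L = All and R = Iso. -/
universe u

/-- A class of morphisms of the category `Set` of sets. -/
abbrev MapClass : Type (u + 1) := ∀ (X Y : Type u), (X → Y) → Prop

/-- `i` has the left lifting property (LLP) with respect to `p`
(equivalently, `p` has the right lifting property (RLP) with respect to `i`):
every commutative square `p ∘ α = β ∘ i` admits a diagonal filler `g`. -/
def LiftSq {A B X Y : Type u} (i : A → B) (p : X → Y) : Prop :=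
  ∀ (α : A → X) (β : B → Y), p ∘ α = β ∘ i →
    ∃ g : B → X, g ∘ i = α ∧ p ∘ g = β

/-- `All`: the class of all set maps. -/
def AllMaps : MapClass.{u} := fun _ _ _ => True

/-- `Iso`: the class of bijections. -/
def IsoMaps : MapClass.{u} := fun _ _ f => Function.Bijective f

/-- `Mono`: the class of injections. -/
def MonoMaps : MapClass.{u} := fun _ _ f => Function.Injective f

/-- `Epi`: the class of surjections. -/
def EpiMaps : MapClass.{u} := fun _ _ f => Function.Surjective f

/-- `SplitMono`: the class of set maps having a left inverse. -/
def SplitMonoMaps : MapClass.{u} := fun X Y f => ∃ g : Y → X, g ∘ f = id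

/-- `Empty`: the class of set maps whose domain is empty. -/
def EmptyMaps : MapClass.{u} := fun X _Y _f => IsEmpty X

/-- `NonEmpty`: the class of set maps whose domain is nonempty. -/
def NonEmptyMaps : MapClass.{u} := fun X _Y _f => Nonempty X

/-- The union of two classes of set maps. -/
def unionMaps (P Q : MapClass.{u}) : MapClass.{u} := fun X Y f => P X Y f ∨ Q X Y f

/-- `(L, R)` is a weak factorization system on the category of sets:
`L` is exactly the class of maps having the LLP with respect to every member of `R`,
`R` is exactly the class of maps having the RLP with respect to every member of `L`,
and every set map factors as `r ∘ l` with `l ∈ L` and `r ∈ R`. -/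
structure IsWFS (L R : MapClass.{u}) : Prop where
  left_iff : ∀ {A B : Type u} (i : A → B),
    L A B i ↔ ∀ {X Y : Type u} (p : X → Y), R X Y p → LiftSq i p
  right_iff : ∀ {X Y : Type u} (p : X → Y),
    R X Y p ↔ ∀ {A B : Type u} (i : A → B), L A B i → LiftSq i p
  factor : ∀ {X Y : Type u} (f : X → Y),
    ∃ (Z : Type u) (l : X → Z) (r : Z → Y), L X Z l ∧ R Z Y r ∧ r ∘ l = f

/-- `C : ∅ → {0}`, the unique map from the empty set to a one-point set. -/
def Cmap : PEmpty.{u + 1} → PUnit.{u + 1} := fun x => x.elim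

theorem LiftSq.surjective {X Y : Type u} {p : X → Y} (hp : LiftSq Cmap.{u} p) :
    Function.Surjective p := by
  intro y
  obtain ⟨g, -, hg⟩ := hp (fun x => x.elim) (fun _ => y) (funext fun x => x.elim)
  exact ⟨g PUnit.unit, congrFun hg PUnit.unit⟩

theorem LiftSq.injective_of_not_injective {A B X Y : Type u} {i : A → B} {p : X → Y}
    (hp : LiftSq i p) (hi : ¬ Function.Injective i) : Function.Injective p := by
  classical
  simp only [Function.Injective, not_forall] at hi
  obtain ⟨a, b, hab, hne⟩ := hi
  intro z w hzw
  obtain ⟨g, hg, -⟩ := hp (fun x => if x = a then z else w) (fun _ => p z) (by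
    funext x
    by_cases hx : x = a <;> simp [hx, hzw])
  have ha : g (i a) = z := by simpa using congrFun hg a
  have hb : g (i b) = w := by simpa [Ne.symm hne] using congrFun hg b
  rw [← ha, ← hb, hab]

theorem LiftSq.of_bijective {A B X Y : Type u} (i : A → B) {p : X → Y}
    (hp : Function.Bijective p) : LiftSq i p := by
  intro α β hsq
  obtain ⟨q, hqp, hpq⟩ := Function.bijective_iff_has_inverse.mp hp
  refine ⟨q ∘ β, ?_, funext fun b => hpq (β b)⟩
  rw [Function.comp_assoc, ← hsq]
  exact funext fun a => hqp (α a)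

/-- If `(L, R)` is a weak factorization system on `Set` with `C ∈ L` and some member
of `L` not injective, then `(L, R) = (All, Iso)`. -/
theorem wfs_eq_all_iso (L R : MapClass.{u}) (h : IsWFS L R)
    (hC : L _ _ Cmap.{u})
    (hnotmono : ∃ (X Y : Type u) (f : X → Y), L X Y f ∧ ¬ Function.Injective f) :
    L = AllMaps ∧ R = IsoMaps := by
  have hR {X Y : Type u} (p : X → Y) (hp : R X Y p) : Function.Bijective p := by
    obtain ⟨A, B, f, hf, hfi⟩ := hnotmono
    exact ⟨((h.right_iff p).mp hp f hf).injective_of_not_injective hfi,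
      ((h.right_iff p).mp hp _ hC).surjective⟩
  constructor
  · funext A B i
    exact eq_true ((h.left_iff i).mpr fun p hp => LiftSq.of_bijective i (hR p hp))
  · funext X Y p
    exact propext ⟨hR p, fun hp => (h.right_iff p).mpr fun i _ => LiftSq.of_bijective i hp⟩
end

section
/- The triple (Cof, Fib, W) = (Mono, Epi ∪ Empty, Iso ∪ NonEmpty) is a model structure on the category Set of sets: the cofibrations are the injections, the fibrations are the set maps that are surjective or have empty domain, and the weak equivalences are the set maps that are bijections or have nonempty domain. -/
universe u

/-- `f` is a retract of `g` in the arrow category of `Set`. -/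
def IsRetract {X Y Z W : Type u} (f : X → Y) (g : Z → W) : Prop :=
  ∃ (i : X → Z) (p : Z → X) (j : Y → W) (q : W → Y),
    p ∘ i = id ∧ q ∘ j = id ∧ g ∘ i = j ∘ f ∧ q ∘ g = f ∘ p

/-- `(Cof, Fib, W)` is a model structure on the category of sets: `W` is closed under
retracts and satisfies the two-out-of-three axiom, and both `(Cof ∩ W, Fib)` and
`(Cof, Fib ∩ W)` are weak factorization systems. -/
structure IsModelStructure (Cof Fib W : MapClass.{u}) : Prop where
  weq_retract : ∀ {X Y Z T : Type u} (f : X → Y) (g : Z → T),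
    IsRetract f g → W Z T g → W X Y f
  weq_comp : ∀ {X Y Z : Type u} (f : X → Y) (g : Y → Z),
    W X Y f → W Y Z g → W X Z (g ∘ f)
  weq_of_comp_left : ∀ {X Y Z : Type u} (f : X → Y) (g : Y → Z),
    W X Y f → W X Z (g ∘ f) → W Y Z g
  weq_of_comp_right : ∀ {X Y Z : Type u} (f : X → Y) (g : Y → Z),
    W Y Z g → W X Z (g ∘ f) → W X Y f
  wfs_trivCof_fib : IsWFS (fun X Y f => Cof X Y f ∧ W X Y f) Fib
  wfs_cof_trivFib : IsWFS Cof (fun X Y f => Fib X Y f ∧ W X Y f)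

/-- The retract argument. -/
theorem IsWFS.of_retract {L R : MapClass.{u}}
    (lift : ∀ {A B X Y : Type u} (i : A → B) (p : X → Y), L A B i → R X Y p → LiftSq i p)
    (left_retract : ∀ {X Y Z W : Type u} (f : X → Y) (g : Z → W),
      IsRetract f g → L Z W g → L X Y f)
    (right_retract : ∀ {X Y Z W : Type u} (f : X → Y) (g : Z → W),
      IsRetract f g → R Z W g → R X Y f)
    (factor : ∀ {X Y : Type u} (f : X → Y),
      ∃ (Z : Type u) (l : X → Z) (r : Z → Y), L X Z l ∧ R Z Y r ∧ r ∘ l = f) :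
    IsWFS L R where
  left_iff i := by
    refine ⟨fun hi _ _ p hp => lift i p hi hp, fun h => ?_⟩
    obtain ⟨Z, l, r, hl, hr, hrl⟩ := factor i
    obtain ⟨g, hgi, hrg⟩ := h r hr l id hrl
    exact left_retract i l ⟨id, id, g, r, rfl, hrg, hgi.symm, hrl⟩ hl
  right_iff p := by
    refine ⟨fun hp _ _ i hi => lift i p hi hp, fun h => ?_⟩
    obtain ⟨Z, l, r, hl, hr, hrl⟩ := factor p
    obtain ⟨g, hgl, hpg⟩ := h l hl id r hrl.symm
    exact right_retract p r ⟨l, g, id, id, hgl, rfl, hrl, hpg.symm⟩ hr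
  factor := factor

namespace IsRetract

variable {X Y Z W : Type u} {f : X → Y} {g : Z → W}

theorem injective (h : IsRetract f g) (hg : Function.Injective g) : Function.Injective f := by
  obtain ⟨i, p, j, q, hpi, -, hgi, -⟩ := h
  have hi : Function.Injective i := Function.LeftInverse.injective (congrFun hpi)
  exact Function.Injective.of_comp (f := j) (hgi ▸ hg.comp hi)

theorem surjective (h : IsRetract f g) (hg : Function.Surjective g) : Function.Surjective f := by
  obtain ⟨i, p, j, q, -, hqj, -, hqg⟩ := h
  have hq : Function.Surjective q := Function.RightInverse.surjective (congrFun hqj)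
  exact Function.Surjective.of_comp (g := p) (hqg ▸ hq.comp hg)

theorem isEmpty (h : IsRetract f g) (hZ : IsEmpty Z) : IsEmpty X :=
  let ⟨i, _⟩ := h
  Function.isEmpty i

theorem nonempty_imp (h : IsRetract f g) (hg : Nonempty W → Nonempty Z) :
    Nonempty Y → Nonempty X :=
  let ⟨_, p, j, _⟩ := h
  fun hY => (hg (hY.map j)).map p

end IsRetract

theorem liftSq_of_injective_of_surjective {A B X Y : Type u} {i : A → B} {p : X → Y}
    (hi : Function.Injective i) (hp : Function.Surjective p) : LiftSq i p := by
  intro α β h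
  obtain ⟨s, hs⟩ := hp.hasRightInverse
  refine ⟨Function.extend i α (s ∘ β), funext (hi.extend_apply _ _), funext fun b => ?_⟩
  by_cases hb : ∃ a, i a = b
  · obtain ⟨a, rfl⟩ := hb
    simpa [hi.extend_apply] using congrFun h a
  · simpa [Function.extend_apply' _ _ _ hb] using hs (β b)

theorem liftSq_of_isEmpty {A B X Y : Type u} {i : A → B} {p : X → Y}
    (hi : Nonempty B → Nonempty A) (hX : IsEmpty X) : LiftSq i p := by
  intro α β _
  have hA : IsEmpty A := Function.isEmpty α
  have hB : IsEmpty B := not_nonempty_iff.1 fun hB => not_isEmpty_iff.2 (hi hB) hA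
  exact ⟨isEmptyElim, Subsingleton.elim _ _, Subsingleton.elim _ _⟩

theorem unionMaps_iso_nonEmpty_eq :
    unionMaps.{u} IsoMaps NonEmptyMaps = fun X Y _ => Nonempty Y → Nonempty X := by
  funext X Y f
  refine propext ⟨?_, fun h => ?_⟩
  · rintro (hf | hX) hY
    · exact hY.map (Equiv.ofBijective f hf).symm
    · exact hX
  · by_cases hX : Nonempty X
    · exact Or.inr hX
    · have := not_nonempty_iff.1 hX
      have := not_nonempty_iff.1 (mt h hX)
      exact Or.inl ⟨Function.injective_of_subsingleton f, isEmptyElim⟩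

theorem trivialFibration_eq_epi :
    (fun X Y f => unionMaps.{u} EpiMaps EmptyMaps X Y f ∧ (Nonempty Y → Nonempty X)) =
      EpiMaps := by
  funext X Y f
  refine propext ⟨?_, fun hf => ⟨Or.inl hf, fun ⟨y⟩ => ⟨(hf y).choose⟩⟩⟩
  rintro ⟨hf | hX, h⟩
  · exact hf
  · exact fun y => (not_isEmpty_iff.2 (h ⟨y⟩) hX).elim

theorem isWFS_mono_epi : IsWFS.{u} MonoMaps EpiMaps :=
  .of_retract (fun _ _ => liftSq_of_injective_of_surjective)
    (fun _ _ => IsRetract.injective) (fun _ _ => IsRetract.surjective)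
    fun {X Y} f => ⟨X ⊕ Y, Sum.inl, Sum.elim f id, Sum.inl_injective, fun y => ⟨Sum.inr y, rfl⟩, rfl⟩

theorem isWFS_trivialCofibration_fibration :
    IsWFS.{u} (fun X Y f => MonoMaps X Y f ∧ (Nonempty Y → Nonempty X))
      (unionMaps EpiMaps EmptyMaps) := by
  refine .of_retract ?_ (fun _ _ h hg => ⟨h.injective hg.1, h.nonempty_imp hg.2⟩)
    (fun _ _ h => Or.imp h.surjective h.isEmpty) fun {X Y} f => ?_
  · rintro A B X Y i p ⟨hi, hBA⟩ (hp | hX)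
    · exact liftSq_of_injective_of_surjective hi hp
    · exact liftSq_of_isEmpty hBA hX
  · rcases isEmpty_or_nonempty X with hX | hX
    · exact ⟨X, id, f, ⟨Function.injective_id, id⟩, Or.inr hX, rfl⟩
    · exact ⟨X ⊕ Y, Sum.inl, Sum.elim f id, ⟨Sum.inl_injective, fun _ => hX⟩,
        Or.inl fun y => ⟨Sum.inr y, rfl⟩, rfl⟩

/-- The triple `(Mono, Epi ∪ Empty, Iso ∪ NonEmpty)` is a model structure on the category of sets. -/
theorem mono_epiOrEmpty_isoOrNonEmpty_isModelStructure :
    IsModelStructure.{u} (MonoMaps) (unionMaps EpiMaps EmptyMaps) (unionMaps IsoMaps NonEmptyMaps) := by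
  rw [unionMaps_iso_nonEmpty_eq]
  exact
    { weq_retract := fun _ _ => IsRetract.nonempty_imp
      weq_comp := fun _ _ hf hg => hf ∘ hg
      weq_of_comp_left := fun f _ _ hgf hZ => (hgf hZ).map f
      weq_of_comp_right := fun _ g _ hgf hY => hgf (hY.map g)
      wfs_trivCof_fib := isWFS_trivialCofibration_fibration
      wfs_cof_trivFib := by simpa only [trivialFibration_eq_epi] using isWFS_mono_epi }
end

section
/- The triple (Cof, Fib, W) = (SplitMono, Epi ∪ Empty, All) is a model structure on the category Set of sets: the cofibrations are the set maps having a left inverse, the fibrations are the set maps that are surjective or have empty domain, and every set map is a weak equivalence. -/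
universe u

/-- Split monos lift against surjections and against maps with empty domain. -/
theorem liftSq_of_splitMono {A B X Y : Type u} {i : A → B} {p : X → Y}
    (hi : SplitMonoMaps A B i) (hp : unionMaps EpiMaps EmptyMaps X Y p) : LiftSq i p := by
  classical
  intro α β h
  obtain ⟨r, hr⟩ := hi
  have hr (a : A) : r (i a) = a := congrFun hr a
  rcases hp with hp | hp
  · obtain ⟨s, hs⟩ := Function.Surjective.hasRightInverse hp
    refine ⟨fun b => if i (r b) = b then α (r b) else s (β b), ?_, ?_⟩
    · funext a
      simp [hr]
    · funext b
      by_cases hb : i (r b) = b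
      · simpa [hb] using congrFun h (r b)
      · simpa [hb] using hs (β b)
  · refine ⟨fun b => α (r b), ?_, ?_⟩
    · funext a
      simp [hr]
    · funext b
      exact IsEmpty.elim hp (α (r b))

/-- Every map to a point is surjective or has empty domain. -/
theorem epiOrEmpty_to_punit (A : Type u) :
    unionMaps EpiMaps EmptyMaps A PUnit.{u + 1} (fun _ => PUnit.unit) := by
  rcases isEmpty_or_nonempty A with h | ⟨⟨a⟩⟩
  · exact Or.inr h
  · exact Or.inl fun _ => ⟨a, rfl⟩

/-- The left coprojection out of a nonempty set is a split mono. -/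
theorem splitMono_inl (X Y : Type u) [Nonempty X] :
    SplitMonoMaps X (X ⊕ Y) Sum.inl :=
  ⟨Sum.elim id fun _ => Classical.arbitrary X, rfl⟩

/-- Split monos on the left, and surjections together with maps of empty domain on the right,
form a weak factorization system. -/
theorem isWFS_splitMono_epiOrEmpty :
    IsWFS.{u} SplitMonoMaps (unionMaps EpiMaps EmptyMaps) where
  left_iff {A B} i := by
    refine ⟨fun hi X Y p hp => liftSq_of_splitMono hi hp, fun h => ?_⟩
    obtain ⟨g, hg, -⟩ := h _ (epiOrEmpty_to_punit A) id (fun _ => PUnit.unit) rfl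
    exact ⟨g, hg⟩
  right_iff {X Y} p := by
    refine ⟨fun hp A B i hi => liftSq_of_splitMono hi hp, fun h => ?_⟩
    rcases isEmpty_or_nonempty X with hX | hX
    · exact Or.inr hX
    · obtain ⟨g, -, hg⟩ := h _ (splitMono_inl X Y) id (Sum.elim p id) rfl
      exact Or.inl fun y => ⟨g (Sum.inr y), congrFun hg (Sum.inr y)⟩
  factor {X Y} f := by
    rcases isEmpty_or_nonempty X with hX | hX
    · exact ⟨X, id, f, ⟨id, rfl⟩, Or.inr hX, rfl⟩
    · exact ⟨X ⊕ Y, Sum.inl, Sum.elim f id, splitMono_inl X Y,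
        Or.inl fun y => ⟨Sum.inr y, rfl⟩, rfl⟩

/-- The triple `(SplitMono, Epi ∪ Empty, All)` is a model structure on the category of sets. -/
theorem splitMono_epiOrEmpty_all_isModelStructure :
    IsModelStructure.{u} (SplitMonoMaps) (unionMaps EpiMaps EmptyMaps) (AllMaps) := by
  refine ⟨fun _ _ _ _ => trivial, fun _ _ _ _ => trivial, fun _ _ _ _ => trivial,
    fun _ _ _ _ => trivial, ?_, ?_⟩
  · simpa only [AllMaps, and_true] using isWFS_splitMono_epiOrEmpty
  · simpa only [AllMaps, and_true] using isWFS_splitMono_epiOrEmpty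
end
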